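/- If B is a Bernstein set and T is a transcendence base of ℝ over ℚ with B ⊆ T, then T is a Bernstein set, the subfield ℚ(T) of ℝ generated by T is a Bernstein field, and ℝ is algebraic over ℚ(T) (equivalently, the algebraic closure of ℚ(T) is ℂ). -/

import Mathlib

noncomputable section

open Set Cardinal

/-- A Cantor set: a nonempty compact subset of ℝ that is totally disconnected
and dense in itself (no isolated points). -/
def IsCantorSet (C : Set ℝ) : Prop :=
  C.Nonempty ∧ IsCompact C ∧ IsTotallyDisconnected C ∧ Preperfect C

/-- A Bernstein set: neither it nor its complement contains a Cantor set. -/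
def IsBernsteinSet (B : Set ℝ) : Prop :=
  (¬ ∃ C ⊆ B, IsCantorSet C) ∧ (¬ ∃ C ⊆ Bᶜ, IsCantorSet C)

/-- A set `S ⊆ ℝ` is algebraically independent (over ℚ). -/
def AlgIndepSet (S : Set ℝ) : Prop := AlgebraicIndependent ℚ ((↑) : S → ℝ)

/-- A transcendence base of ℝ over ℚ: a maximal algebraically independent subset. -/
def IsTransBase (S : Set ℝ) : Prop :=
  AlgIndepSet S ∧ ∀ x : ℝ, x ∉ S → ¬ AlgIndepSet (insert x S)

theorem IsTransBase.isTranscendenceBasis {T : Set ℝ} (hT : IsTransBase T) :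
    IsTranscendenceBasis ℚ ((↑) : T → ℝ) := by
  refine isTranscendenceBasis_iff_maximal.2 ⟨hT.1, fun S hS hTS x hx ↦ ?_⟩
  by_contra hxT
  exact hT.2 x hxT (AlgebraicIndependent.mono (insert_subset hx hTS) hS)

theorem subfield_closure_eq_adjoin_rat (T : Set ℝ) :
    Subfield.closure T = (IntermediateField.adjoin ℚ T).toSubfield := by
  refine le_antisymm (Subfield.closure_le.2 (IntermediateField.subset_adjoin ℚ T)) ?_
  rw [IntermediateField.adjoin_toSubfield, Subfield.closure_le]
  rintro x (⟨q, rfl⟩ | hx)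
  · exact SubfieldClass.ratCast_mem _ q
  · exact Subfield.subset_closure hx

theorem MvPolynomial.eq_zero_of_sq_eq_two_mul_sq {σ : Type*} {p q : MvPolynomial σ ℚ}
    (h : p ^ 2 = 2 * q ^ 2) : q = 0 := by
  ext m
  let f := Rat.castHom ℝ
  have h2 : (C √2 : MvPolynomial σ ℝ) ^ 2 = 2 := by
    rw [← map_pow, Real.sq_sqrt zero_le_two, map_ofNat]
  have hsq : map f p ^ 2 = (C √2 * map f q) ^ 2 := by
    rw [mul_pow, h2, ← map_pow, h, map_mul, map_pow, map_ofNat]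
  have hm : f (coeff m p) ^ 2 = (√2 * f (coeff m q)) ^ 2 := by
    rcases sq_eq_sq_iff_eq_or_eq_neg.1 hsq with h | h <;>
      have hc := congrArg (coeff m) h <;>
      simp only [coeff_neg, coeff_map, coeff_C_mul] at hc
    · rw [hc]
    · rw [hc, neg_sq]
  by_contra hq
  rw [coeff_zero] at hq
  have hq' : f (coeff m q) ≠ 0 := (map_ne_zero f).2 hq
  refine irrational_sqrt_two ⟨|coeff m p / coeff m q|, ?_⟩
  rw [← abs_of_nonneg (Real.sqrt_nonneg 2), Rat.cast_abs]
  refine (sq_eq_sq_iff_abs_eq_abs _ _).1 ?_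
  rw [Rat.cast_div, div_pow]
  exact (div_eq_iff (pow_ne_zero 2 hq')).2 (hm.trans (mul_pow _ _ _))

theorem AlgIndepSet.sqrt_two_notMem_closure {T : Set ℝ} (hT : AlgIndepSet T) :
    √2 ∉ Subfield.closure T := by
  rw [subfield_closure_eq_adjoin_rat]
  intro h
  obtain ⟨r, hr, s, hs, hrs⟩ := IntermediateField.mem_adjoin_iff_div.1 h
  rw [← Subtype.range_coe (s := T), Algebra.adjoin_range_eq_range_aeval] at hr hs
  obtain ⟨p, rfl⟩ := hr
  obtain ⟨q, rfl⟩ := hs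
  have hq : MvPolynomial.aeval ((↑) : T → ℝ) q ≠ 0 := by
    intro hq
    exact (Real.sqrt_ne_zero'.2 zero_lt_two) (by rw [hrs]; exact div_eq_zero_iff.2 (.inr hq))
  refine hq ?_
  rw [MvPolynomial.eq_zero_of_sq_eq_two_mul_sq (p := p) (q := q) (hT ?_), map_zero]
  have hpq := (eq_div_iff hq).1 hrs
  rw [map_pow, map_mul, map_pow, map_ofNat]
  refine Eq.trans (congrArg (· ^ 2) hpq.symm) ?_
  simp only [mul_pow, Real.sq_sqrt zero_le_two]

theorem Preperfect.image_homeomorph {X Y : Type*} [TopologicalSpace X] [TopologicalSpace Y]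
    (e : X ≃ₜ Y) {C : Set X} (hC : Preperfect C) : Preperfect (e '' C) := by
  rw [preperfect_iff_nhds] at hC ⊢
  rintro _ ⟨x, hx, rfl⟩ U hU
  obtain ⟨y, ⟨hyU, hyC⟩, hyx⟩ := hC x hx _ (e.continuous.continuousAt hU)
  exact ⟨e y, ⟨hyU, mem_image_of_mem e hyC⟩, e.injective.ne hyx⟩

theorem IsCantorSet.image_homeomorph (e : ℝ ≃ₜ ℝ) {C : Set ℝ} (hC : IsCantorSet C) :
    IsCantorSet (e '' C) :=
  ⟨hC.1.image e, hC.2.1.image e.continuous,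
    e.isEmbedding.isTotallyDisconnected_image.2 hC.2.2.1, hC.2.2.2.image_homeomorph e⟩

theorem not_isCantorSet_of_subset_closure {B T C : Set ℝ} (hB : IsBernsteinSet B)
    (hT : AlgIndepSet T) (hBT : B ⊆ T) (hC : C ⊆ Subfield.closure T) : ¬ IsCantorSet C := by
  intro hCantor
  have h2 : √2 ≠ 0 := Real.sqrt_ne_zero'.2 zero_lt_two
  refine hB.2 ⟨_, ?_, hCantor.image_homeomorph (Homeomorph.mulLeft₀ √2 h2)⟩
  rintro _ ⟨c, hc, rfl⟩ hcB
  have hcT : √2 * c ∈ T := hBT hcB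
  have hc0 : c ≠ 0 := right_ne_zero_of_mul (AlgebraicIndependent.ne_zero hT ⟨_, hcT⟩)
  refine hT.sqrt_two_notMem_closure ?_
  rw [← mul_div_cancel_right₀ √2 hc0]
  exact div_mem (Subfield.subset_closure hcT) (hC hc)

/-- If B is a Bernstein set contained in a transcendence base T, then T is a
Bernstein set, ℚ(T) is a Bernstein field, and ℝ is algebraic over ℚ(T). -/
theorem bernstein_transBase (B T : Set ℝ) (hB : IsBernsteinSet B)
    (hT : IsTransBase T) (hBT : B ⊆ T) :
    IsBernsteinSet T ∧ Subfield.closure T ≠ ⊤ ∧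
      IsBernsteinSet ((Subfield.closure T : Subfield ℝ) : Set ℝ) ∧
      Algebra.IsAlgebraic (Subfield.closure T) ℝ := by
  have hsub : T ⊆ Subfield.closure T := Subfield.subset_closure
  refine ⟨⟨?_, ?_⟩, ?_, ⟨?_, ?_⟩, ?_⟩
  · rintro ⟨C, hC, hCantor⟩
    exact not_isCantorSet_of_subset_closure hB hT.1 hBT (hC.trans hsub) hCantor
  · rintro ⟨C, hC, hCantor⟩
    exact hB.2 ⟨C, hC.trans (compl_subset_compl.2 hBT), hCantor⟩
  · intro h
    exact hT.1.sqrt_two_notMem_closure (h ▸ Subfield.mem_top _)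
  · rintro ⟨C, hC, hCantor⟩
    exact not_isCantorSet_of_subset_closure hB hT.1 hBT hC hCantor
  · rintro ⟨C, hC, hCantor⟩
    exact hB.2 ⟨C, hC.trans (compl_subset_compl.2 (hBT.trans hsub)), hCantor⟩
  · have h := hT.isTranscendenceBasis.isAlgebraic_field
    rw [Subtype.range_coe] at h
    rw [subfield_closure_eq_adjoin_rat]
    exact h
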